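/- (Partial theta function identity.) Let θ(w; p) = ∑_{n=0}^∞ (−1)^n p^{n(n−1)/2} w^n. Let q, z ∈ ℂ with |q| < 1 and z ≠ −q^{−m} for every integer m ≥ 1. Then (zq;q)_∞ / (−zq;q)_∞ + ∑_{n=0}^∞ [ (−1;q)_n (z;q)_n / ((q;q)_n (−zq;q)_n) ] (−z)^n q^{n²+n} = ∑_{n=0}^∞ [ (−1;q)_n (z;q)_n / ((q;q)_n (−zq;q)_n) ] · (1 + q^n + z q^n − z q^{2n}) (−z)^n q^{n²} · θ(z² q^{2n+1}; q²), all series involved converging absolutely. -/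

import Mathlib

/-- The finite q-Pochhammer symbol `(x;q)_n = ∏_{i=0}^{n-1} (1 - x q^i)`. -/
noncomputable def qPoch (q x : ℂ) (n : ℕ) : ℂ :=
  ∏ i ∈ Finset.range n, (1 - x * q ^ i)

/-- The partial theta function `θ(w;p) = ∑_{n≥0} (−1)^n p^{n(n−1)/2} w^n`. -/
noncomputable def partialTheta (w p : ℂ) : ℂ :=
  ∑' n : ℕ, (-1 : ℂ) ^ n * p ^ (n * (n - 1) / 2) * w ^ n


open Filter Topology

lemma qP_succ (q x : ℂ) (n : ℕ) : qPoch q x (n+1) = qPoch q x n * (1 - x * q ^ n) := by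
  simp [qPoch, Finset.prod_range_succ]

lemma qP_zero (q x : ℂ) : qPoch q x 0 = 1 := by simp [qPoch]

lemma qP_succ' (q x : ℂ) (n : ℕ) : qPoch q x (n+1) = (1 - x) * qPoch q (x * q) n := by
  simp only [qPoch, Finset.prod_range_succ', pow_zero, mul_one]
  rw [mul_comm]
  congr 1
  apply Finset.prod_congr rfl
  intro i _
  ring

lemma qP_ne (q x : ℂ) (h : ∀ i : ℕ, 1 - x * q ^ i ≠ 0) (n : ℕ) : qPoch q x n ≠ 0 :=
  Finset.prod_ne_zero_iff.mpr fun i _ => h i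

lemma qP_add (q x : ℂ) (n m : ℕ) : qPoch q x (n + m) = qPoch q x n * qPoch q (x * q ^ n) m := by
  simp only [qPoch, Finset.prod_range_add]
  congr 1
  apply Finset.prod_congr rfl
  intro i _
  ring

lemma summ_xq (q x : ℂ) (hq : ‖q‖ < 1) : Summable (fun i : ℕ => ‖-(x * q ^ i)‖) := by
  simp only [norm_neg, norm_mul, norm_pow]
  exact (summable_geometric_of_lt_one (norm_nonneg _) hq).mul_left _

lemma qP_tendsto (q x : ℂ) (hq : ‖q‖ < 1) :
    Tendsto (qPoch q x) atTop (𝓝 (∏' i : ℕ, (1 - x * q ^ i))) := by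
  have h := (multipliable_one_add_of_summable (summ_xq q x hq)).hasProd.tendsto_prod_nat
  simp only [← sub_eq_add_neg] at h
  exact h

lemma qP_tprod_ne (q x : ℂ) (hq : ‖q‖ < 1) (h : ∀ i : ℕ, 1 - x * q ^ i ≠ 0) :
    (∏' i : ℕ, (1 - x * q ^ i)) ≠ 0 := by
  have h := tprod_one_add_ne_zero_of_summable (f := fun i : ℕ => -(x * q ^ i))
    (by simpa only [← sub_eq_add_neg] using h) (summ_xq q x hq)
  simpa only [← sub_eq_add_neg] using h

lemma qP_upper (q : ℂ) (hq : ‖q‖ < 1) (R : ℝ) :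
    ∃ C : ℝ, 0 < C ∧ ∀ x : ℂ, ‖x‖ ≤ R → ∀ n, ‖qPoch q x n‖ ≤ C := by
  refine ⟨Real.exp (|R| * (1 - ‖q‖)⁻¹), Real.exp_pos _, fun x hx n => ?_⟩
  have hs := summable_geometric_of_lt_one (norm_nonneg _) hq
  unfold qPoch
  rw [norm_prod]
  calc ∏ i ∈ Finset.range n, ‖1 - x * q ^ i‖
      ≤ ∏ i ∈ Finset.range n, (1 + |R| * ‖q‖ ^ i) := by
        apply Finset.prod_le_prod
        · intros; positivity
        · intro i _
          refine (norm_sub_le _ _).trans ?_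
          rw [norm_one, norm_mul, norm_pow]
          gcongr
          exact hx.trans (le_abs_self R)
    _ ≤ Real.exp (∑ i ∈ Finset.range n, |R| * ‖q‖ ^ i) :=
        Real.prod_one_add_le_exp_sum _ (fun i => by positivity)
    _ ≤ _ := by
        apply Real.exp_le_exp.mpr
        rw [← Finset.mul_sum]
        gcongr
        rw [← tsum_geometric_of_lt_one (norm_nonneg _) hq]
        exact hs.sum_le_tsum _ (fun i _ => by positivity)

lemma qP_lower (q x : ℂ) (hq : ‖q‖ < 1) (h : ∀ i : ℕ, 1 - x * q ^ i ≠ 0) :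
    ∃ C : ℝ, 0 < C ∧ ∀ n, ‖(qPoch q x n)⁻¹‖ ≤ C := by
  have h1 := ((qP_tendsto q x hq).inv₀ (qP_tprod_ne q x hq h)).norm
  obtain ⟨C, hC⟩ := h1.bddAbove_range
  refine ⟨max C 1, by positivity, fun n => le_max_of_le_left (hC ⟨n, rfl⟩)⟩

lemma summ_gauss (r s : ℝ) (hr : 0 ≤ r) (hs : 0 ≤ s) (hs1 : s < 1) :
    Summable (fun n : ℕ => r ^ n * s ^ (n ^ 2)) := by
  have h0 : Tendsto (fun n : ℕ => r * s ^ n) atTop (𝓝 0) := by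
    simpa using (tendsto_pow_atTop_nhds_zero_of_lt_one hs hs1).const_mul r
  have h1 : ∀ᶠ n : ℕ in atTop, r * s ^ n < 1 / 2 := h0.eventually_lt_const (by norm_num)
  refine Summable.of_norm_bounded_eventually_nat (g := fun n => (1 / 2 : ℝ) ^ n)
    (summable_geometric_of_lt_one (by norm_num) (by norm_num)) ?_
  filter_upwards [h1] with n hn
  rw [pow_two, pow_mul, ← mul_pow, Real.norm_of_nonneg (by positivity)]
  gcongr

lemma qq_ne (q : ℂ) (hq : ‖q‖ < 1) (i : ℕ) : 1 - q * q ^ i ≠ 0 := by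
  intro h
  have h1 : q ^ (i+1) = 1 := by rw [pow_succ']; linear_combination -h
  have h2 : ‖q‖ ^ (i+1) < 1 := pow_lt_one₀ (norm_nonneg _) hq (by omega)
  rw [← norm_pow, h1] at h2
  simp at h2

/-- summand of the very-well-poised series -/
noncomputable def TT (q z : ℂ) : ℕ → ℂ
  | 0 => 1
  | (N+1) => qPoch q (-1) (N+1) * qPoch q (z*q) N / (qPoch q q (N+1) * qPoch q (-(z*q)) (N+1))
      * (1 - z * q ^ (2 * (N+1))) * (-z) ^ (N+1) * q ^ ((N+1)^2)

lemma TT_sum (q z : ℂ) (hq : ‖q‖ < 1) (hz : ∀ i : ℕ, 1 - (-(z*q)) * q ^ i ≠ 0) (M : ℕ) :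
    ∑ N ∈ Finset.range (M+1), ((1 + z*q) * TT q z N - (1 - z*q) * TT q (z*q) N)
      = -(qPoch q (-1) (M+1) * qPoch q (z*q) M / (qPoch q q M * qPoch q (-(z*q*q)) M)
        * (-z) ^ (M+1) * q ^ ((M+1)^2)) := by
  have hz2 : ∀ i : ℕ, 1 - (-(z*q*q)) * q ^ i ≠ 0 := by
    intro i h; apply hz (i+1); rw [← h]; ring
  induction M with
  | zero => simp [TT, qPoch]; ring
  | succ M ih =>
    rw [Finset.sum_range_succ, ih]
    simp only [TT]
    have e1 : qPoch q (-(z*q)) (M+1) = (1 + z*q) * qPoch q (-(z*q*q)) M := by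
      rw [qP_succ']; congr 1
      · ring
      · congr 1; ring
    have e2 : (1 - z*q) * qPoch q (z*q*q) M = qPoch q (z*q) M * (1 - z*q*q^M) := by
      rw [← qP_succ', qP_succ]
    have e3 : (1 - z*q) * (qPoch q (-1) (M+1) * qPoch q (z*q*q) M / (qPoch q q (M+1) * qPoch q (-(z*q*q)) (M+1))
      * (1 - z * q * q ^ (2 * (M+1))) * (-(z*q)) ^ (M+1) * q ^ ((M+1)^2)) =
       (qPoch q (-1) (M+1) * (qPoch q (z*q) M * (1 - z*q*q^M)) / (qPoch q q (M+1) * qPoch q (-(z*q*q)) (M+1))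
      * (1 - z * q * q ^ (2 * (M+1))) * (-(z*q)) ^ (M+1) * q ^ ((M+1)^2)) := by
      rw [← e2]; ring
    rw [e3, e1, qP_succ q (-1) (M+1), qP_succ q q M, qP_succ q (-(z*q*q)) M, qP_succ q (z*q) M]
    have n1 := qP_ne q q (qq_ne q hq) M
    have n2 := qP_ne q _ hz2 M
    have n3 := qq_ne q hq M
    have n4 := hz2 M
    have n5 : 1 + z * q ≠ 0 := by simpa using hz 0
    generalize qPoch q (-1) (M+1) = A
    generalize qPoch q (z*q) M = B at *
    generalize qPoch q q M = D at *
    generalize qPoch q (-(z*q*q)) M = E at *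
    have p1 : q ^ ((M+1+1)^2) = q ^ ((M+1)^2) * (q^M)^2 * q^3 := by ring
    have p2 : q ^ (2 * (M+1)) = (q^M)^2 * q^2 := by ring
    have p3 : (-(z*q))^(M+1) = (-z)^(M+1) * q^M * q := by rw [neg_mul_eq_neg_mul, mul_pow]; ring
    have p4 : q ^ (M+1) = q^M * q := pow_succ _ _
    rw [p1, p2, p3, p4, pow_succ (-z) (M+1)]
    generalize q ^ ((M+1)^2) = X
    generalize (-z)^(M+1) = Y
    generalize q ^ M = x at *
    have n6 : 1 - -(z*q*q)*x = 1 + z*q^2*x := by ring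
    rw [n6] at n4 ⊢
    clear ih e1 e2 e3 p1 p2 p3 p4
    field_simp
    ring

lemma zq_ne_shift (q z : ℂ) (hz : ∀ i : ℕ, 1 - (-(z*q)) * q ^ i ≠ 0) (n : ℕ) :
    ∀ i : ℕ, 1 - (-(z*q^n*q)) * q ^ i ≠ 0 := by
  intro i h; apply hz (n+i); rw [← h]; ring

lemma TT_bound (q z : ℂ) (hq : ‖q‖ < 1) (hz : ∀ i : ℕ, 1 - (-(z*q)) * q ^ i ≠ 0) :
    ∃ K : ℝ, 0 < K ∧ ∀ n N, ‖TT q (z*q^n) N‖ ≤ K * ((‖z‖ * ‖q‖^n) ^ N * ‖q‖ ^ (N^2)) := by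
  obtain ⟨C1, h1, H1⟩ := qP_upper q hq 1
  obtain ⟨C2, h2, H2⟩ := qP_upper q hq ‖z‖
  obtain ⟨C3, h3, H3⟩ := qP_lower q q hq (qq_ne q hq)
  obtain ⟨C4, h4, H4⟩ := qP_lower q _ hq hz
  have hp : ∀ n, ‖q‖ ^ n ≤ 1 := fun n => pow_le_one₀ (norm_nonneg _) hq.le
  have hzq : ∀ n m, ‖z * q ^ n * q ^ m‖ ≤ ‖z‖ := by
    intro n m
    rw [mul_assoc, ← pow_add, norm_mul, norm_pow]
    exact mul_le_of_le_one_right (norm_nonneg _) (hp _)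
  refine ⟨max 1 (C1 * C2 * (C3 * (C2 * C4)) * (1 + ‖z‖)), by positivity, fun n N => ?_⟩
  cases N with
  | zero => simp [TT]
  | succ N =>
    have a1 : ‖qPoch q (-1) (N+1)‖ ≤ C1 := H1 _ (by simp) _
    have a2 : ‖qPoch q (z*q^n*q) N‖ ≤ C2 := H2 _ (by simpa using hzq n 1) _
    have a3 := H3 (N+1)
    have a4 : ‖(qPoch q (-(z*q^n*q)) (N+1))⁻¹‖ ≤ C2 * C4 := by
      have e := qP_add q (-(z*q)) n (N+1)
      have e' : -(z*q) * q^n = -(z*q^n*q) := by ring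
      rw [e'] at e
      have b1 := qP_ne q _ hz n
      have b2 := qP_ne q _ (zq_ne_shift q z hz n) (N+1)
      have : (qPoch q (-(z*q^n*q)) (N+1))⁻¹ = qPoch q (-(z*q)) n * (qPoch q (-(z*q)) (n+(N+1)))⁻¹ := by
        rw [e]; field_simp
      rw [this, norm_mul]
      gcongr
      · apply H2
        simpa using hzq 0 1
      · apply H4
    have a5 : ‖1 - z*q^n * q ^ (2*(N+1))‖ ≤ 1 + ‖z‖ := by
      refine (norm_sub_le _ _).trans ?_
      rw [norm_one]
      gcongr
      exact hzq _ _
    simp only [TT]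
    rw [div_eq_mul_inv, mul_inv, norm_mul, norm_mul, norm_mul, norm_mul, norm_mul, norm_mul,
      norm_pow, norm_pow, norm_neg, norm_mul z, norm_pow, mul_assoc (_ * _ * _) (_ ^ (N+1))]
    apply mul_le_mul_of_nonneg_right _ (by positivity)
    refine le_max_of_le_right ?_
    gcongr

lemma TT_summable (q z : ℂ) (hq : ‖q‖ < 1) (hz : ∀ i : ℕ, 1 - (-(z*q)) * q ^ i ≠ 0) :
    Summable (TT q z) := by
  obtain ⟨K, hK, H⟩ := TT_bound q z hq hz
  refine Summable.of_norm_bounded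
    ((summ_gauss ‖z‖ ‖q‖ (norm_nonneg _) (norm_nonneg _) hq).mul_left K) fun N => ?_
  simpa using H 0 N

lemma TT_func (q z : ℂ) (hq : ‖q‖ < 1) (hz : ∀ i : ℕ, 1 - (-(z*q)) * q ^ i ≠ 0) :
    (1 + z*q) * ∑' N, TT q z N = (1 - z*q) * ∑' N, TT q (z*q) N := by
  have hz2 : ∀ i : ℕ, 1 - (-(z*q*q)) * q ^ i ≠ 0 := by simpa using zq_ne_shift q z hz 1
  have s1 := (TT_summable q z hq hz).mul_left (1 + z*q)
  have s2 := (TT_summable q (z*q) hq hz2).mul_left (1 - z*q)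
  have hs := ((s1.sub s2).hasSum.tendsto_sum_nat).comp (tendsto_add_atTop_nat 1)
  have h0 : Tendsto ((fun n : ℕ => ∑ N ∈ Finset.range n, ((1 + z*q) * TT q z N - (1 - z*q) * TT q (z*q) N)) ∘ (fun a => a + 1))
      atTop (𝓝 0) := by
    obtain ⟨C1, h1, H1⟩ := qP_upper q hq 1
    obtain ⟨C2, h2, H2⟩ := qP_upper q hq ‖z*q‖
    obtain ⟨C3, h3, H3⟩ := qP_lower q q hq (qq_ne q hq)
    obtain ⟨C4, h4, H4⟩ := qP_lower q _ hq hz2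
    have hg := ((summ_gauss ‖z‖ ‖q‖ (norm_nonneg _) (norm_nonneg _) hq).mul_left
      (C1 * C2 * (C3 * C4))).tendsto_atTop_zero.comp (tendsto_add_atTop_nat 1)
    refine squeeze_zero_norm (fun M => ?_) hg
    simp only [Function.comp_apply]
    rw [TT_sum q z hq hz M]
    have a1 : ‖qPoch q (-1) (M+1)‖ ≤ C1 := H1 _ (by simp) _
    have a2 : ‖qPoch q (z*q) M‖ ≤ C2 := H2 _ le_rfl _
    have a3 := H3 M
    have a4 := H4 M
    rw [norm_neg, div_eq_mul_inv, mul_inv, norm_mul, norm_mul, norm_mul, norm_mul, norm_mul,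
      norm_pow, norm_pow, norm_neg, mul_assoc (_ * _) (_ ^ (M+1))]
    gcongr
  have := tendsto_nhds_unique hs h0
  rw [s1.tsum_sub s2, tsum_mul_left, tsum_mul_left] at this
  exact sub_eq_zero.mp this

lemma TT_iter (q z : ℂ) (hq : ‖q‖ < 1) (hz : ∀ i : ℕ, 1 - (-(z*q)) * q ^ i ≠ 0) (n : ℕ) :
    qPoch q (-(z*q)) n * ∑' N, TT q z N = qPoch q (z*q) n * ∑' N, TT q (z*q^n) N := by
  induction n with
  | zero => simp [qP_zero]
  | succ n ih =>
    have := TT_func q (z*q^n) hq (zq_ne_shift q z hz n)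
    rw [qP_succ, qP_succ, pow_succ, ← mul_assoc z]
    linear_combination (1 - -(z*q)*q^n) * ih + qPoch q (z*q) n * this

lemma TT_lim (q z : ℂ) (hq : ‖q‖ < 1) (hz : ∀ i : ℕ, 1 - (-(z*q)) * q ^ i ≠ 0) :
    Tendsto (fun n : ℕ => ∑' N, TT q (z*q^n) N) atTop (𝓝 1) := by
  obtain ⟨K, hK, H⟩ := TT_bound q z hq hz
  have h1 : (1:ℂ) = ∑' N : ℕ, if N = 0 then (1:ℂ) else 0 := by simp
  rw [h1]
  have hp : ∀ n, ‖q‖ ^ n ≤ 1 := fun n => pow_le_one₀ (norm_nonneg _) hq.le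
  refine tendsto_tsum_of_dominated_convergence
    ((summ_gauss ‖z‖ ‖q‖ (norm_nonneg _) (norm_nonneg _) hq).mul_left K) ?_ ?_
  · intro N
    cases N with
    | zero => simp [TT]
    | succ N =>
      simp only [Nat.add_eq_zero_iff, one_ne_zero, and_false, if_false]
      have h0 : Tendsto (fun n : ℕ => K * ((‖z‖ * ‖q‖^n) ^ (N+1) * ‖q‖ ^ ((N+1)^2))) atTop (𝓝 0) := by
        have := ((((tendsto_pow_atTop_nhds_zero_of_lt_one (norm_nonneg q) hq).const_mul ‖z‖).pow
          (N+1)).mul_const (‖q‖ ^ ((N+1)^2))).const_mul K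
        simpa using this
      exact squeeze_zero_norm (fun n => H n (N+1)) h0
  · refine Eventually.of_forall fun n N => (H n N).trans ?_
    gcongr
    exact mul_le_of_le_one_right (norm_nonneg _) (hp _)

lemma TT_tsum (q z : ℂ) (hq : ‖q‖ < 1) (hz : ∀ i : ℕ, 1 - (-(z*q)) * q ^ i ≠ 0) :
    (∏' i : ℕ, (1 - z * q * q ^ i)) / (∏' i : ℕ, (1 + z * q * q ^ i)) = ∑' N, TT q z N := by
  have e : (∏' i : ℕ, (1 + z * q * q ^ i)) = ∏' i : ℕ, (1 - (-(z * q)) * q ^ i) := by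
    congr 1; ext i; ring
  rw [e, div_eq_iff (qP_tprod_ne q _ hq hz)]
  have l1 := (qP_tendsto q (-(z*q)) hq).mul_const (∑' N, TT q z N)
  have l2 := (qP_tendsto q (z*q) hq).mul (TT_lim q z hq hz)
  simp_rw [TT_iter q z hq hz] at l1
  rw [mul_comm (tsum _), tendsto_nhds_unique l1 l2, mul_one]

/-- the coefficient -/
noncomputable def bb (q z : ℂ) (n : ℕ) : ℂ :=
  qPoch q (-1) n * qPoch q z n / (qPoch q q n * qPoch q (-(z * q)) n)

/-- the summed coefficient -/
noncomputable def ee (q z : ℂ) (n : ℕ) : ℂ :=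
  qPoch q (-1) n * (1 + q^n) * qPoch q (z*q) n / (qPoch q q n * qPoch q (-(z * q)) n)

lemma ee_sum (q z : ℂ) (hq : ‖q‖ < 1) (hz : ∀ i : ℕ, 1 - (-(z*q)) * q ^ i ≠ 0) (N : ℕ) :
    ∑ x ∈ Finset.HasAntidiagonal.antidiagonal N,
      bb q z x.1 * (1 + q ^ x.1 + z * q ^ x.1 - z * q ^ (2 * x.1)) * z ^ x.2 = ee q z N := by
  induction N with
  | zero => simp [bb, ee, qP_zero]
  | succ N ih =>
    rw [Finset.Nat.sum_antidiagonal_succ']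
    simp only [pow_succ z, ← mul_assoc, ← Finset.sum_mul, ih]
    unfold bb ee
    rw [qP_succ q (-1) N, qP_succ' q z N, qP_succ q q N, qP_succ q (-(z*q)) N, qP_succ q (z*q) N]
    have n1 := qP_ne q q (qq_ne q hq) N
    have n2 := qP_ne q _ hz N
    have n3 := qq_ne q hq N
    have n4 := hz N
    have p2 : q ^ (2 * (N+1)) = (q^N)^2 * q^2 := by ring
    rw [p2, pow_succ q N]
    clear ih p2
    generalize qPoch q (-1) N = A
    generalize qPoch q (z*q) N = B at *
    generalize qPoch q q N = D at *
    generalize qPoch q (-(z*q)) N = E at *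
    generalize q ^ N = x at *
    have n6 : 1 - -(z*q)*x = 1 + z*q*x := by ring
    rw [n6] at n4 ⊢
    clear n6
    generalize hU : 1 - q*x = U at *
    generalize hV : 1 + z*q*x = V at *
    field_simp
    rw [← hU, ← hV]
    ring

lemma ee_TT (q z : ℂ) (N : ℕ) :
    TT q z N + bb q z N * (-z)^N * q^(N^2+N) = ee q z N * ((-z)^N * q^(N^2)) := by
  cases N with
  | zero => simp [TT, bb, ee, qP_zero]
  | succ N =>
    unfold bb ee
    simp only [TT]
    rw [qP_succ' q z N, qP_succ q (z*q) N, pow_add q _ (N+1), mul_comm 2 (N+1), pow_mul, pow_succ q N]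
    generalize q ^ ((N+1)^2) = X
    ring

lemma bb_bound (q z : ℂ) (hq : ‖q‖ < 1) (hz : ∀ i : ℕ, 1 - (-(z*q)) * q ^ i ≠ 0) :
    ∃ K : ℝ, 0 < K ∧ ∀ n, ‖bb q z n‖ ≤ K := by
  obtain ⟨C1, h1, H1⟩ := qP_upper q hq 1
  obtain ⟨C2, h2, H2⟩ := qP_upper q hq ‖z‖
  obtain ⟨C3, h3, H3⟩ := qP_lower q q hq (qq_ne q hq)
  obtain ⟨C4, h4, H4⟩ := qP_lower q _ hq hz
  refine ⟨C1 * C2 * (C3 * C4), by positivity, fun n => ?_⟩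
  unfold bb
  rw [div_eq_mul_inv, mul_inv, norm_mul, norm_mul, norm_mul]
  have a1 : ‖qPoch q (-1) n‖ ≤ C1 := H1 _ (by simp) _
  have a2 : ‖qPoch q z n‖ ≤ C2 := H2 _ le_rfl _
  have a3 := H3 n
  have a4 := H4 n
  gcongr

lemma theta_term (q z : ℂ) (m n : ℕ) :
    (-1 : ℂ) ^ n * (q ^ 2) ^ (n * (n - 1) / 2) * (z ^ 2 * q ^ (2 * m + 1)) ^ n
      = (-(z^2))^n * q ^ (n^2 + 2*m*n) := by
  have h : 2 * (n * (n-1) / 2) = n * (n-1) := Nat.mul_div_cancel' (Nat.even_mul_pred_self n).two_dvd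
  have h2 : n * (n-1) + (2*m+1)*n = n^2 + 2*m*n := by
    cases n with
    | zero => simp
    | succ n => simp; ring
  rw [← pow_mul, h, mul_pow, ← pow_mul q, ← h2, pow_add q, neg_pow (z^2)]
  ring

lemma theta_summable (q z : ℂ) (hq : ‖q‖ < 1) (m : ℕ) :
    Summable (fun n : ℕ => (-(z^2))^n * q ^ (n^2 + 2*m*n)) := by
  refine Summable.of_norm_bounded
    (summ_gauss (‖z‖^2) ‖q‖ (by positivity) (norm_nonneg _) hq) fun n => ?_
  rw [norm_mul, norm_pow, norm_neg, norm_pow, norm_pow]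
  gcongr ?_ * ?_
  exact pow_le_pow_of_le_one (norm_nonneg _) hq.le (by omega)

lemma first_summable (q z : ℂ) (hq : ‖q‖ < 1) (hz : ∀ i : ℕ, 1 - (-(z*q)) * q ^ i ≠ 0) :
    Summable (fun n : ℕ => bb q z n * (-z)^n * q^(n^2+n)) := by
  obtain ⟨K, hK, H⟩ := bb_bound q z hq hz
  refine Summable.of_norm_bounded
    ((summ_gauss ‖z‖ ‖q‖ (norm_nonneg _) (norm_nonneg _) hq).mul_left K) fun n => ?_
  rw [mul_assoc, norm_mul, norm_mul, norm_pow, norm_neg, norm_pow]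
  gcongr ?_ * (_ * ?_)
  · exact H n
  · exact pow_le_pow_of_le_one (norm_nonneg _) hq.le (by omega)

/-- the double series -/
noncomputable def dd (q z : ℂ) (x : ℕ × ℕ) : ℂ :=
  bb q z x.1 * ((1 + q ^ x.1 + z * q ^ x.1 - z * q ^ (2 * x.1)) * (-z) ^ x.1 * q ^ (x.1 ^ 2) *
    ((-(z^2))^x.2 * q ^ (x.2^2 + 2*x.1*x.2)))

lemma dd_summable (q z : ℂ) (hq : ‖q‖ < 1) (hz : ∀ i : ℕ, 1 - (-(z*q)) * q ^ i ≠ 0) :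
    Summable (dd q z) := by
  obtain ⟨K, hK, H⟩ := bb_bound q z hq hz
  have g1 := (summ_gauss ‖z‖ ‖q‖ (norm_nonneg _) (norm_nonneg _) hq).mul_left
    (K * (1 + 1 + ‖z‖ + ‖z‖))
  have g2 := summ_gauss (‖z‖^2) ‖q‖ (by positivity) (norm_nonneg _) hq
  have hp : ∀ n, ‖q‖ ^ n ≤ 1 := fun n => pow_le_one₀ (norm_nonneg _) hq.le
  refine Summable.of_norm_bounded
    (g1.mul_of_nonneg g2 (fun n => by positivity) (fun n => by positivity)) ?_
  rintro ⟨n, k⟩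
  simp only [dd]
  have hw : ‖1 + q ^ n + z * q ^ n - z * q ^ (2 * n)‖ ≤ 1 + 1 + ‖z‖ + ‖z‖ := by
    refine (norm_sub_le _ _).trans (add_le_add ((norm_add_le _ _).trans
      (add_le_add ((norm_add_le _ _).trans (add_le_add (by simp) ?_)) ?_)) ?_)
    · rw [norm_pow]; exact hp _
    · rw [norm_mul, norm_pow]; exact mul_le_of_le_one_right (norm_nonneg _) (hp _)
    · rw [norm_mul, norm_pow]; exact mul_le_of_le_one_right (norm_nonneg _) (hp _)
  have hk : ‖q‖ ^ (k^2+2*n*k) ≤ ‖q‖ ^ (k^2) :=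
    pow_le_pow_of_le_one (norm_nonneg _) hq.le (by omega)
  calc _ = ‖bb q z n‖ * ‖1 + q ^ n + z * q ^ n - z * q ^ (2 * n)‖ * (‖z‖ ^ n * ‖q‖ ^ n ^ 2) *
        ((‖z‖ ^ 2) ^ k * ‖q‖ ^ (k ^ 2 + 2*n*k)) := by
        simp only [norm_mul, norm_pow, norm_neg]; ring
    _ ≤ _ := by
      gcongr
      exact H n

lemma dd_sum (q z : ℂ) (hq : ‖q‖ < 1) (hz : ∀ i : ℕ, 1 - (-(z*q)) * q ^ i ≠ 0) (N : ℕ) :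
    ∑ x ∈ Finset.HasAntidiagonal.antidiagonal N, dd q z x = ee q z N * ((-z)^N * q^(N^2)) := by
  rw [← ee_sum q z hq hz, Finset.sum_mul]
  apply Finset.sum_congr rfl
  rintro ⟨n, k⟩ hx
  obtain rfl := Finset.HasAntidiagonal.mem_antidiagonal.mp hx
  simp only [dd]
  have : q ^ ((n+k)^2) = q ^ (n^2) * q ^ (k^2+2*n*k) := by ring
  rw [this, show -(z^2) = (-z) * z by ring, mul_pow, pow_add (-z)]
  ring

lemma dd_row (q z : ℂ) (hq : ‖q‖ < 1) (n : ℕ) :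
    HasSum (fun k => dd q z (n, k)) (bb q z n *
        ((1 + q ^ n + z * q ^ n - z * q ^ (2 * n)) * (-z) ^ n * q ^ (n ^ 2) *
          partialTheta (z ^ 2 * q ^ (2 * n + 1)) (q ^ 2))) := by
  unfold partialTheta
  simp only [theta_term, dd]
  exact ((theta_summable q z hq n).hasSum.mul_left _).mul_left _

lemma dd_tsum (q z : ℂ) (hq : ‖q‖ < 1) (hz : ∀ i : ℕ, 1 - (-(z*q)) * q ^ i ≠ 0) :
    HasSum (fun N => ee q z N * ((-z)^N * q^(N^2))) (∑' x, dd q z x) := by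
  have h := (Finset.HasAntidiagonal.sigmaAntidiagonalEquivProd (A := ℕ)).hasSum_iff.mpr
    (dd_summable q z hq hz).hasSum
  refine h.sigma fun N => ?_
  rw [← dd_sum q z hq hz]
  exact Finset.hasSum (Finset.HasAntidiagonal.antidiagonal N) (dd q z)

/-- The partial theta function identity:
`(zq;q)_∞/(−zq;q)_∞ + ∑_n (−1;q)_n (z;q)_n/((q;q)_n (−zq;q)_n) (−z)^n q^{n²+n}
 = ∑_n (−1;q)_n (z;q)_n/((q;q)_n (−zq;q)_n)
     (1 + q^n + z q^n − z q^{2n}) (−z)^n q^{n²} θ(z²q^{2n+1};q²)`,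
all series involved converging absolutely. -/
theorem partial_theta_identity (q z : ℂ) (hq : ‖q‖ < 1)
    (hz : ∀ m : ℕ, 1 ≤ m → z ≠ -q ^ (-(m : ℤ))) :
    Summable (fun n : ℕ =>
      qPoch q (-1) n * qPoch q z n / (qPoch q q n * qPoch q (-(z * q)) n) *
        (-z) ^ n * q ^ (n ^ 2 + n)) ∧
    (∀ m : ℕ, Summable (fun n : ℕ =>
      (-1 : ℂ) ^ n * (q ^ 2) ^ (n * (n - 1) / 2) * (z ^ 2 * q ^ (2 * m + 1)) ^ n)) ∧
    Summable (fun n : ℕ =>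
      qPoch q (-1) n * qPoch q z n / (qPoch q q n * qPoch q (-(z * q)) n) *
        ((1 + q ^ n + z * q ^ n - z * q ^ (2 * n)) * (-z) ^ n * q ^ (n ^ 2) *
          partialTheta (z ^ 2 * q ^ (2 * n + 1)) (q ^ 2))) ∧
    (∏' i : ℕ, (1 - z * q * q ^ i)) / (∏' i : ℕ, (1 + z * q * q ^ i)) +
        (∑' n : ℕ,
          qPoch q (-1) n * qPoch q z n / (qPoch q q n * qPoch q (-(z * q)) n) *
            (-z) ^ n * q ^ (n ^ 2 + n))
      = ∑' n : ℕ,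
          qPoch q (-1) n * qPoch q z n / (qPoch q q n * qPoch q (-(z * q)) n) *
            ((1 + q ^ n + z * q ^ n - z * q ^ (2 * n)) * (-z) ^ n * q ^ (n ^ 2) *
              partialTheta (z ^ 2 * q ^ (2 * n + 1)) (q ^ 2)) := by
  have hz' : ∀ i : ℕ, 1 - (-(z*q)) * q ^ i ≠ 0 := by
    intro i h
    have h1 : z * q ^ (i+1) = -1 := by rw [pow_succ']; linear_combination h
    have hq0 : q ^ (i+1) ≠ 0 := by
      intro h0; rw [h0] at h1; simp at h1
    apply hz (i+1) (by omega)
    rw [zpow_neg, zpow_natCast]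
    field_simp
    exact h1
  have hd := (dd_summable q z hq hz').hasSum.prod_fiberwise (dd_row q z hq)
  refine ⟨first_summable q z hq hz', ?_, hd.summable, ?_⟩
  · intro m
    simp only [theta_term]
    exact theta_summable q z hq m
  · refine Eq.trans ?_ hd.tsum_eq.symm
    rw [TT_tsum q z hq hz', ← (dd_tsum q z hq hz').tsum_eq]
    refine ((TT_summable q z hq hz').tsum_add (first_summable q z hq hz')).symm.trans ?_
    exact tsum_congr (ee_TT q z)
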